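/- arXiv:1810.05250 — 2 statements merged into one kernel-verified Lean document; each statement's English description precedes it below -/
import Mathlib

section
/- Let X, Y, Z be finite-alphabet discrete-time random processes with a given joint probability mass function, and fix n ≥ 1. For each i, the expectation over positive-probability histories (X^{i-1}, Y^{i-1}, Z^{i-1}) of the sample path causal measure C_{Y→X}(i) = D(p^(c)_i ‖ p^(r)_i) satisfies: ∑_{i=1}^n E[ C_{Y→X}(i) ] = ∑_{i=1}^n I(Y^{i-1}; X_i ∣ X^{i-1}, Z^{i-1}), the causally conditioned directed information I(Y^{n-1} → X^n ∣∣ Z^{n-1}). Here I(Y^{i-1}; X_i ∣ X^{i-1}, Z^{i-1}) = ∑ P(X^i = x^i, Y^{i-1} = y^{i-1}, Z^{i-1} = z^{i-1}) · log[ P(X_i = x_i ∣ X^{i-1}=x^{i-1}, Y^{i-1}=y^{i-1}, Z^{i-1}=z^{i-1}) / P(X_i = x_i ∣ X^{i-1}=x^{i-1}, Z^{i-1}=z^{i-1}) ], the sum ranging over realizations of positive probability. -/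
open Finset
open scoped Classical

noncomputable section

/-- Probability of the event `A` under the pmf `P` on a finite sample space. -/
def prob {Ω : Type*} [Fintype Ω] (P : Ω → ℝ) (A : Ω → Prop) : ℝ :=
  ∑ ω, if A ω then P ω else 0

/-- Conditional probability of `A` given `B` (with the junk value `0` when `B` has
probability zero, via division by zero). -/
def cprob {Ω : Type*} [Fintype Ω] (P : Ω → ℝ) (A B : Ω → Prop) : ℝ :=
  prob P (fun ω => A ω ∧ B ω) / prob P B

/-- Kullback–Leibler divergence (base 2) between pmfs on a finite alphabet, with the
convention `0 * log (0 / q) = 0` (automatic since `Real.log 0 = 0`). -/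
def kl {α : Type*} [Fintype α] (p q : α → ℝ) : ℝ :=
  ∑ x, p x * Real.logb 2 (p x / q x)

/-- The event that the process `X` agrees with its realization at `ω` on all indices `j`
with `1 ≤ j`, `a ≤ j` and `j ≤ b` (processes are indexed starting at time 1). -/
def hist {Ω α : Type*} (X : ℕ → Ω → α) (a b : ℕ) (ω : Ω) : Ω → Prop :=
  fun ω' => ∀ j, 1 ≤ j → a ≤ j → j ≤ b → X j ω' = X j ω

/-- Conditional Shannon entropy (base 2) of `U` given the conditioning family of events `E`
(`E ω` is the conditioning event realized at sample point `ω`). -/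
def condEntB {Ω α : Type*} [Fintype Ω] (P : Ω → ℝ) (U : Ω → α) (E : Ω → Ω → Prop) : ℝ :=
  -(∑ ω, P ω * Real.logb 2 (cprob P (fun ω' => U ω' = U ω) (E ω)))

/-- Binary KL divergence (base 2) between Bernoulli parameters `a` and `b`. -/
def dBin (a b : ℝ) : ℝ :=
  a * Real.logb 2 (a / b) + (1 - a) * Real.logb 2 ((1 - a) / (1 - b))

theorem prob_congr {Ω : Type*} [Fintype Ω] (P : Ω → ℝ) {A B : Ω → Prop}
    (h : ∀ ω, A ω ↔ B ω) : prob P A = prob P B := by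
  rw [show A = B from funext fun ω => propext (h ω)]

theorem le_prob {Ω : Type*} [Fintype Ω] {P : Ω → ℝ} (hP : ∀ ω, 0 ≤ P ω) {A : Ω → Prop}
    {ω : Ω} (h : A ω) : P ω ≤ prob P A := by
  have := Finset.single_le_sum (f := fun ω' => if A ω' then P ω' else 0)
    (fun ω' _ => by split_ifs <;> simp [hP]) (Finset.mem_univ ω)
  simpa [prob, h] using this

theorem sum_cprob_mul {Ω α : Type*} [Fintype Ω] [Fintype α] (P : Ω → ℝ) (U : Ω → α)
    (B : Ω → Prop) (f : α → ℝ) :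
    ∑ x, cprob P (fun ω => U ω = x) B * f x =
      ∑ ω, if B ω then P ω * f (U ω) / prob P B else 0 := by
  have h : ∀ x, cprob P (fun ω => U ω = x) B * f x =
      ∑ ω, if U ω = x then (if B ω then P ω * f x / prob P B else 0) else 0 := by
    intro x
    rw [cprob, prob, Finset.sum_div, Finset.sum_mul]
    refine Finset.sum_congr rfl fun ω _ => ?_
    by_cases h₁ : U ω = x <;> by_cases h₂ : B ω <;> simp [h₁, h₂, div_mul_eq_mul_div]
  rw [Finset.sum_congr rfl fun x _ => h x, Finset.sum_comm]
  exact Finset.sum_congr rfl fun ω _ => by simp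

/-- The tower property for a conditional expectation given a partition, the partition being
presented as an equivalence relation. -/
theorem sum_mul_sum_cprob_mul {Ω α : Type*} [Fintype Ω] [Fintype α] {P : Ω → ℝ}
    (hP : ∀ ω, 0 ≤ P ω) (U : Ω → α) {E : Ω → Ω → Prop} (hE : Equivalence E)
    {f : Ω → α → ℝ} (hf : ∀ ω ω', E ω ω' → f ω = f ω') :
    ∑ ω, P ω * ∑ x, cprob P (fun ω' => U ω' = x) (E ω) * f ω x =
      ∑ ω, P ω * f ω (U ω) := by
  simp_rw [sum_cprob_mul, Finset.mul_sum]
  rw [Finset.sum_comm]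
  refine Finset.sum_congr rfl fun ω _ => ?_
  have h : ∀ ω', P ω' * (if E ω' ω then P ω * f ω' (U ω) / prob P (E ω') else 0) =
      (if E ω ω' then P ω' else 0) * (P ω * f ω (U ω) / prob P (E ω)) := by
    intro ω'
    by_cases h₁ : E ω ω'
    · rw [if_pos h₁, if_pos (hE.symm h₁), hf ω ω' h₁, prob_congr P fun ω'' =>
        (⟨hE.trans h₁, hE.trans (hE.symm h₁)⟩ : E ω' ω'' ↔ E ω ω'')]
    · rw [if_neg h₁, if_neg fun h₂ => h₁ (hE.symm h₂), mul_zero, zero_mul]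
  rw [Finset.sum_congr rfl fun ω' _ => h ω', ← Finset.sum_mul]
  change prob P (E ω) * _ = _
  by_cases h₀ : prob P (E ω) = 0
  · have : P ω = 0 := le_antisymm (h₀ ▸ le_prob hP (hE.refl ω)) (hP ω)
    simp [this]
  · exact mul_div_cancel₀ _ h₀

theorem equivalence_hist {Ω α : Type*} (X : ℕ → Ω → α) (a b : ℕ) :
    Equivalence (hist X a b) where
  refl _ _ _ _ _ := rfl
  symm h j h₁ h₂ h₃ := (h j h₁ h₂ h₃).symm
  trans h h' j h₁ h₂ h₃ := (h' j h₁ h₂ h₃).trans (h j h₁ h₂ h₃)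

theorem equivalence_and {Ω : Type*} {E F : Ω → Ω → Prop} (hE : Equivalence E)
    (hF : Equivalence F) : Equivalence fun ω ω' => E ω ω' ∧ F ω ω' where
  refl ω := ⟨hE.refl ω, hF.refl ω⟩
  symm h := ⟨hE.symm h.1, hF.symm h.2⟩
  trans h h' := ⟨hE.trans h.1 h'.1, hF.trans h.2 h'.2⟩

theorem Equivalence.apply_eq {Ω : Type*} {E : Ω → Ω → Prop} (hE : Equivalence E) {ω ω' : Ω}
    (h : E ω ω') : E ω = E ω' :=
  funext fun _ => propext ⟨hE.trans (hE.symm h), hE.trans h⟩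

/-- The expected divergence between the conditional laws of `U` given a fine and a coarse
partition is the expected log-likelihood ratio. -/
theorem sum_mul_kl_cprob {Ω α : Type*} [Fintype Ω] [Fintype α] {P : Ω → ℝ}
    (hP : ∀ ω, 0 ≤ P ω) (U : Ω → α) {E F : Ω → Ω → Prop} (hE : Equivalence E)
    (hF : Equivalence F) (hEF : ∀ ω ω', E ω ω' → F ω ω') :
    ∑ ω, P ω * kl (fun x => cprob P (fun ω' => U ω' = x) (E ω))
        (fun x => cprob P (fun ω' => U ω' = x) (F ω)) =
      ∑ ω, P ω * Real.logb 2 (cprob P (fun ω' => U ω' = U ω) (E ω) /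
        cprob P (fun ω' => U ω' = U ω) (F ω)) :=
  sum_mul_sum_cprob_mul hP U hE
    (f := fun ω x => Real.logb 2 (cprob P (fun ω' => U ω' = x) (E ω) /
      cprob P (fun ω' => U ω' = x) (F ω)))
    fun ω ω' h => by simp only [hE.apply_eq h, hF.apply_eq (hEF ω ω' h)]

/-- The sum over `i = 1, …, n` of the expectation (over positive-probability
histories, i.e. weighted by the pmf `P` on the sample space) of the sample path causal
measure `C_{Y→X}(i) = D(p^(c)_i ‖ p^(r)_i)` equals the causally conditioned directed
information `I(Y^{n-1} → X^n ∣∣ Z^{n-1}) = ∑_{i=1}^n I(Y^{i-1}; X_i ∣ X^{i-1}, Z^{i-1})`. -/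
theorem expected_causal_measure_eq_directed_information
    {Ω 𝒳 𝒴 𝒵 : Type*} [Fintype Ω] [Fintype 𝒳] [Fintype 𝒴] [Fintype 𝒵]
    (P : Ω → ℝ) (hP : ∀ ω, 0 ≤ P ω) (hPsum : ∑ ω, P ω = 1)
    (X : ℕ → Ω → 𝒳) (Y : ℕ → Ω → 𝒴) (Z : ℕ → Ω → 𝒵)
    (n : ℕ) (hn : 1 ≤ n) :
    (∑ i ∈ Finset.Icc 1 n, ∑ ω, P ω *
        kl (fun x => cprob P (fun ω' => X i ω' = x)
              (fun ω' => hist X 1 (i - 1) ω ω' ∧ hist Y 1 (i - 1) ω ω' ∧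
                hist Z 1 (i - 1) ω ω'))
           (fun x => cprob P (fun ω' => X i ω' = x)
              (fun ω' => hist X 1 (i - 1) ω ω' ∧ hist Z 1 (i - 1) ω ω')))
      =
      ∑ i ∈ Finset.Icc 1 n, ∑ ω, P ω *
        Real.logb 2
          (cprob P (fun ω' => X i ω' = X i ω)
              (fun ω' => hist X 1 (i - 1) ω ω' ∧ hist Y 1 (i - 1) ω ω' ∧
                hist Z 1 (i - 1) ω ω') /
            cprob P (fun ω' => X i ω' = X i ω)
              (fun ω' => hist X 1 (i - 1) ω ω' ∧ hist Z 1 (i - 1) ω ω')) := by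
  refine Finset.sum_congr rfl fun i _ => ?_
  have hX := equivalence_hist X 1 (i - 1)
  have hY := equivalence_hist Y 1 (i - 1)
  have hZ := equivalence_hist Z 1 (i - 1)
  exact sum_mul_kl_cprob hP (X i) (equivalence_and hX (equivalence_and hY hZ))
    (equivalence_and hX hZ) fun _ _ h => ⟨h.1, h.2.2⟩

end
end

section
/- Let 𝒳 be a nonempty finite alphabet, n ≥ 1, and for each i = 1,…,n let p̂^(c)_i, p̂^(r)_i (the complete and restricted sequential predictor outputs) and p*^(c)_i, p*^(r)_i (the loss-minimizing complete and restricted reference distributions) be strictly positive probability mass functions on 𝒳. Suppose: (i) M_c ≥ 1 and ∑_{i=1}^n D(p*^(c)_i ‖ p̂^(c)_i) ≤ M_c; (ii) M_r ≥ 0 and ∑_{i=1}^n | E_{p*^(c)_i}[ log( p*^(r)_i(X) / p̂^(r)_i(X) ) ] | ≤ M_r. Define the estimated causal measure Ĉ(i) = D(p̂^(c)_i ‖ p̂^(r)_i) and the reference causal measure C*(i) = D(p*^(c)_i ‖ p*^(r)_i). Then the causality regret satisfies CR(n) = ∑_{i=1}^n | Ĉ(i) − C*(i) | ≤ M_c +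 M_r + (‖c‖₂ / √2) · √M_c, where c = (c_1,…,c_n) with c_i = ∑_{x ∈ 𝒳} | log( p̂^(c)_i(x) / p̂^(r)_i(x) ) |. -/
open Finset
open scoped Classical

noncomputable section

lemma two_mul_sub_one_le_mul_log {t : ℝ} (ht : 1 ≤ t) :
    2 * (t - 1) ≤ (t + 1) * Real.log t := by
  have h := Real.le_log_one_add_of_nonneg (sub_nonneg.2 ht)
  rw [add_sub_cancel, div_le_iff₀ (by linarith)] at h
  linarith

lemma mul_log_le_two_mul_sub_one {t : ℝ} (ht₀ : 0 < t) (ht : t ≤ 1) :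
    (t + 1) * Real.log t ≤ 2 * (t - 1) := by
  have h := mul_le_mul_of_nonneg_left (two_mul_sub_one_le_mul_log ((one_le_inv₀ ht₀).2 ht)) ht₀.le
  rw [Real.log_inv] at h
  have h₁ : t * (2 * (t⁻¹ - 1)) = 2 * (1 - t) := by field_simp
  have h₂ : t * ((t⁻¹ + 1) * -Real.log t) = -((t + 1) * Real.log t) := by
    field_simp
    ring
  linarith

/-- The scalar inequality behind Pinsker's inequality. -/
lemma three_mul_sub_one_sq_le {t : ℝ} (ht : 0 < t) :
    3 * (t - 1) ^ 2 ≤ (2 * t + 4) * (t * Real.log t - t + 1) := by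
  let g : ℝ → ℝ := fun t => (2 * t + 4) * (t * Real.log t - t + 1) - 3 * (t - 1) ^ 2
  have hg : ∀ x, 0 < x → HasDerivAt g (4 * ((x + 1) * Real.log x - 2 * (x - 1))) x := by
    intro x hx
    have h₁ : HasDerivAt (fun t : ℝ => 2 * t + 4) (2 * 1) x :=
      ((hasDerivAt_id x).const_mul 2).add_const 4
    have h₂ : HasDerivAt (fun t : ℝ => t * Real.log t - t + 1) (Real.log x + 1 - 1) x :=
      ((Real.hasDerivAt_mul_log hx.ne').sub (hasDerivAt_id x)).add_const 1
    have h₃ := (((hasDerivAt_id x).sub_const 1).pow 2).const_mul 3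
    refine ((h₁.mul h₂).sub h₃).congr_deriv ?_
    simp only [id]
    push_cast
    ring
  have hg₁ : g 1 = 0 := by simp [g]
  suffices h : g 1 ≤ g t by
    rw [hg₁] at h
    exact sub_nonneg.1 h
  rcases le_total 1 t with h | h
  · refine monotoneOn_of_hasDerivWithinAt_nonneg (convex_Icc 1 t)
      (fun x hx => (hg x (by linarith [hx.1])).continuousAt.continuousWithinAt)
      (fun x hx => (hg x ?_).hasDerivWithinAt) ?_ ⟨le_rfl, h⟩ ⟨h, le_rfl⟩ h
    · rw [interior_Icc] at hx
      linarith [hx.1]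
    · intro x hx
      rw [interior_Icc] at hx
      linarith [two_mul_sub_one_le_mul_log hx.1.le]
  · refine antitoneOn_of_hasDerivWithinAt_nonpos (convex_Icc t 1)
      (fun x hx => (hg x (by linarith [hx.1])).continuousAt.continuousWithinAt)
      (fun x hx => (hg x ?_).hasDerivWithinAt) ?_ ⟨le_rfl, h⟩ ⟨h, le_rfl⟩ h
    · rw [interior_Icc] at hx
      linarith [hx.1]
    · intro x hx
      rw [interior_Icc] at hx
      linarith [mul_log_le_two_mul_sub_one (ht.trans hx.1) hx.2.le]

section Pinsker

variable {α : Type*} [Fintype α] {p q : α → ℝ}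

lemma kl_mul_log_two (p q : α → ℝ) :
    kl p q * Real.log 2 = ∑ x, p x * Real.log (p x / q x) := by
  have h : Real.log 2 ≠ 0 := (Real.log_pos one_lt_two).ne'
  rw [kl, sum_mul]
  refine sum_congr rfl fun x _ => ?_
  rw [Real.logb]
  field_simp

/-- **Pinsker's inequality** for strictly positive probability mass functions. -/
lemma sum_abs_sub_sq_le_kl (hp : ∀ x, 0 < p x) (hq : ∀ x, 0 < q x)
    (hp₁ : ∑ x, p x = 1) (hq₁ : ∑ x, q x = 1) :
    (∑ x, |p x - q x|) ^ 2 ≤ 2 * (kl p q * Real.log 2) := by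
  have hpt : ∀ x, |p x - q x| ^ 2 ≤
      ((2 * p x + 4 * q x) / 3) * (p x * Real.log (p x / q x) - p x + q x) := by
    intro x
    have hqx := hq x
    have h := mul_le_mul_of_nonneg_left (three_mul_sub_one_sq_le (div_pos (hp x) hqx))
      (sq_nonneg (q x))
    have h₁ : q x ^ 2 * (3 * (p x / q x - 1) ^ 2) = 3 * (p x - q x) ^ 2 := by
      field_simp
    have h₂ : q x ^ 2 * ((2 * (p x / q x) + 4) *
        (p x / q x * Real.log (p x / q x) - p x / q x + 1)) =
        (2 * p x + 4 * q x) * (p x * Real.log (p x / q x) - p x + q x) := by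
      generalize Real.log (p x / q x) = l
      field_simp
    rw [sq_abs]
    linarith
  have hpos : ∀ x, 0 < (2 * p x + 4 * q x) / 3 := fun x => by linarith [hp x, hq x]
  have h := sum_sq_le_sum_mul_sum_of_sq_le_mul univ (fun x _ => (hpos x).le)
    (fun x _ => nonneg_of_mul_nonneg_right ((sq_nonneg _).trans (hpt x)) (hpos x))
    (fun x _ => hpt x)
  rw [← sum_div, sum_add_distrib, sum_add_distrib, sum_sub_distrib, ← mul_sum, ← mul_sum, hp₁,
    hq₁, ← kl_mul_log_two] at h
  linarith

lemma kl_nonneg (hp : ∀ x, 0 < p x) (hq : ∀ x, 0 < q x)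
    (hp₁ : ∑ x, p x = 1) (hq₁ : ∑ x, q x = 1) : 0 ≤ kl p q := by
  refine nonneg_of_mul_nonneg_left ?_ (Real.log_pos one_lt_two)
  linarith [sum_abs_sub_sq_le_kl hp hq hp₁ hq₁, sq_nonneg (∑ x, |p x - q x|)]

lemma two_mul_abs_sub_le_sum (h : ∑ x, p x = ∑ x, q x) (x : α) :
    2 * |p x - q x| ≤ ∑ y, |p y - q y| := by
  have h₀ : ∑ y, (p y - q y) = 0 := by rw [sum_sub_distrib, h, sub_self]
  have h₁ := add_sum_erase univ (fun y => p y - q y) (mem_univ x)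
  rw [h₀] at h₁
  have h₂ := abs_sum_le_sum_abs (fun y => p y - q y) (univ.erase x)
  rw [eq_neg_of_add_eq_zero_right h₁, abs_neg] at h₂
  linarith [add_sum_erase univ (fun y => |p y - q y|) (mem_univ x)]

/-- Pointwise form of Pinsker's inequality, with the divergence measured in bits. -/
lemma abs_sub_le_sqrt_kl (hp : ∀ x, 0 < p x) (hq : ∀ x, 0 < q x)
    (hp₁ : ∑ x, p x = 1) (hq₁ : ∑ x, q x = 1) (x : α) :
    |p x - q x| ≤ √(kl p q / 2) := by
  refine Real.le_sqrt_of_sq_le ?_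
  have h₁ := pow_le_pow_left₀ (by positivity) (two_mul_abs_sub_le_sum (hp₁.trans hq₁.symm) x) 2
  have h₂ := sum_abs_sub_sq_le_kl hp hq hp₁ hq₁
  have h₃ : kl p q * Real.log 2 ≤ kl p q * 1 :=
    mul_le_mul_of_nonneg_left (by linarith [Real.log_two_lt_d9]) (kl_nonneg hp hq hp₁ hq₁)
  linarith [mul_pow 2 |p x - q x| 2]

end Pinsker

lemma kl_sub_kl_eq {α : Type*} [Fintype α] {p r p' r' : α → ℝ} (hp : ∀ x, 0 < p x)
    (hr : ∀ x, 0 < r x) (hp' : ∀ x, 0 < p' x) (hr' : ∀ x, 0 < r' x) :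
    kl p r - kl p' r' = ∑ x, (p x - p' x) * Real.logb 2 (p x / r x) - kl p' p +
      ∑ x, p' x * Real.logb 2 (r' x / r x) := by
  simp only [kl, ← sum_sub_distrib, ← sum_add_distrib]
  refine sum_congr rfl fun x _ => ?_
  rw [Real.logb_div (hp x).ne' (hr x).ne', Real.logb_div (hp' x).ne' (hr' x).ne',
    Real.logb_div (hp' x).ne' (hp x).ne', Real.logb_div (hr' x).ne' (hr x).ne']
  ring

/-- Bound on the change of a divergence when both of its arguments change. -/
lemma abs_kl_sub_kl_le {α : Type*} [Fintype α] {p r p' r' : α → ℝ} (hp : ∀ x, 0 < p x)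
    (hr : ∀ x, 0 < r x) (hp' : ∀ x, 0 < p' x) (hr' : ∀ x, 0 < r' x)
    (hp₁ : ∑ x, p x = 1) (hp'₁ : ∑ x, p' x = 1) :
    |kl p r - kl p' r'| ≤ kl p' p + |∑ x, p' x * Real.logb 2 (r' x / r x)| +
      (∑ x, |Real.logb 2 (p x / r x)|) * √(kl p' p / 2) := by
  have h : |∑ x, (p x - p' x) * Real.logb 2 (p x / r x)| ≤
      (∑ x, |Real.logb 2 (p x / r x)|) * √(kl p' p / 2) := by
    refine (abs_sum_le_sum_abs _ _).trans ?_
    rw [sum_mul]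
    refine sum_le_sum fun x _ => ?_
    rw [abs_mul, mul_comm, abs_sub_comm]
    exact mul_le_mul_of_nonneg_left (abs_sub_le_sqrt_kl hp' hp hp'₁ hp₁ x) (abs_nonneg _)
  rw [kl_sub_kl_eq hp hr hp' hr']
  refine (abs_add_le _ _).trans ?_
  have h' := abs_sub (∑ x, (p x - p' x) * Real.logb 2 (p x / r x)) (kl p' p)
  rw [abs_of_nonneg (kl_nonneg hp' hp hp'₁ hp₁)] at h'
  linarith

/-- Finite-sample bound on the causality regret. If the cumulative KL from the
reference complete distributions to the complete predictors is at most `Mc ≥ 1`, and the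
cumulative absolute expected regret of the restricted predictor (under the reference complete
distributions) is at most `Mr ≥ 0`, then
`CR(n) = ∑ᵢ |Ĉ(i) − C*(i)| ≤ Mc + Mr + (‖c‖₂/√2)·√Mc` with
`c_i = ∑_x |log(p̂ᶜᵢ(x)/p̂ʳᵢ(x))|`. -/
theorem causality_regret_bound
    {𝒳 : Type*} [Fintype 𝒳] [Nonempty 𝒳] (n : ℕ) (hn : 1 ≤ n)
    (pcHat prHat pcStar prStar : Fin n → 𝒳 → ℝ)
    (hpcHat : ∀ i x, 0 < pcHat i x) (hpcHatSum : ∀ i, ∑ x, pcHat i x = 1)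
    (hprHat : ∀ i x, 0 < prHat i x) (hprHatSum : ∀ i, ∑ x, prHat i x = 1)
    (hpcStar : ∀ i x, 0 < pcStar i x) (hpcStarSum : ∀ i, ∑ x, pcStar i x = 1)
    (hprStar : ∀ i x, 0 < prStar i x) (hprStarSum : ∀ i, ∑ x, prStar i x = 1)
    (Mc Mr : ℝ) (hMc : 1 ≤ Mc) (hMr : 0 ≤ Mr)
    (hKLc : ∑ i, kl (pcStar i) (pcHat i) ≤ Mc)
    (hRefr : ∑ i, |∑ x, pcStar i x * Real.logb 2 (prStar i x / prHat i x)| ≤ Mr) :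
    ∑ i, |kl (pcHat i) (prHat i) - kl (pcStar i) (prStar i)| ≤
      Mc + Mr +
        Real.sqrt (∑ i, (∑ x, |Real.logb 2 (pcHat i x / prHat i x)|) ^ 2) / Real.sqrt 2 *
          Real.sqrt Mc := by
  have hkl : ∀ i, 0 ≤ kl (pcStar i) (pcHat i) := fun i =>
    kl_nonneg (hpcStar i) (hpcHat i) (hpcStarSum i) (hpcHatSum i)
  have hterm := sum_le_sum fun i (_ : i ∈ univ) =>
    abs_kl_sub_kl_le (hpcHat i) (hprHat i) (hpcStar i) (hprStar i) (hpcHatSum i) (hpcStarSum i)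
  rw [sum_add_distrib, sum_add_distrib] at hterm
  have hcs := Real.sum_mul_le_sqrt_mul_sqrt univ
    (fun i => ∑ x, |Real.logb 2 (pcHat i x / prHat i x)|)
    (fun i => √(kl (pcStar i) (pcHat i) / 2))
  have hsq : ∑ i, √(kl (pcStar i) (pcHat i) / 2) ^ 2 ≤ Mc / 2 := by
    simp only [Real.sq_sqrt (div_nonneg (hkl _) zero_le_two)]
    rw [← sum_div]
    linarith
  have hmono := mul_le_mul_of_nonneg_left (Real.sqrt_le_sqrt hsq)
    (Real.sqrt_nonneg (∑ i, (∑ x, |Real.logb 2 (pcHat i x / prHat i x)|) ^ 2))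
  rw [Real.sqrt_div' _ zero_le_two, mul_div_left_comm, mul_comm √Mc] at hmono
  linarith

end
end
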